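/- Let E be a real inner product space, n ≥ 1, and f₁,…,f_n : E → ℝ differentiable with L-Lipschitz gradients (L > 0); set F = (1/n)·Σ_j f_j. Suppose f_i is bounded below with infimum f_i*. Let α ∈ [0,1], let v̂, w, w₁,…,w_n ∈ E, and set v̄ = v̂ + (1−α)·(w_i − w). Then ‖α²·∇f_i(v̄) + (1−α)·(1/n)·Σ_j ∇f_j(w_j)‖² ≤ 8L·(α² + 1 − α)·(f_i(v̂) − f_i*) + 4(1−α)²·L²·‖w − w_i‖² + 6(1−α)²·( L²·‖w − w_i‖² + ‖∇f_i(v̂) − ∇F(w)‖² + (L²/n)·Σ_j ‖w − w_j‖² ). -/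

import Mathlib

/-- A lower bound of a function with `L`-Lipschitz gradient controls the squared norm of the
gradient. -/
theorem norm_gradient_sq_le_of_lipschitz
    {E : Type*} [NormedAddCommGroup E] [InnerProductSpace ℝ E]
    {f : E → ℝ} {g : E → E} {L m : ℝ} (hL : 0 < L)
    (hg : ∀ x, HasFDerivAt f (innerSL ℝ (g x)) x)
    (hLip : ∀ x y, ‖g x - g y‖ ≤ L * ‖x - y‖)
    (hm : ∀ x, m ≤ f x) (x : E) :
    ‖g x‖ ^ 2 ≤ 4 * L * (f x - m) := by
  have hline (t : ℝ) : HasDerivAt (fun t : ℝ => f (x - t • g x))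
      (inner ℝ (g (x - t • g x)) (-g x)) t := by
    have h : HasDerivAt (fun t : ℝ => x - t • g x) (-g x) t := by
      simpa using ((hasDerivAt_id t).smul_const (g x)).const_sub x
    simpa [Function.comp_def] using (hg (x - t • g x)).comp_hasDerivAt t h
  have ht : (0 : ℝ) < 1 / (2 * L) := by positivity
  obtain ⟨τ, ⟨hτ0, hτ1⟩, hτ⟩ := exists_hasDerivAt_eq_slope _ _ ht
    (fun t _ => (hline t).continuousAt.continuousWithinAt) (fun t _ => hline t)
  have hdiff : ‖g x - g (x - τ • g x)‖ ≤ 1 / 2 * ‖g x‖ := by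
    calc ‖g x - g (x - τ • g x)‖ ≤ L * (τ * ‖g x‖) := by
          simpa [norm_smul, abs_of_pos hτ0] using hLip x (x - τ • g x)
      _ ≤ L * (1 / (2 * L) * ‖g x‖) := by gcongr
      _ = 1 / 2 * ‖g x‖ := by field_simp
  have hinner : inner ℝ (g x - g (x - τ • g x)) (g x) ≤ 1 / 2 * ‖g x‖ ^ 2 := by
    calc inner ℝ (g x - g (x - τ • g x)) (g x)
        ≤ ‖g x - g (x - τ • g x)‖ * ‖g x‖ := real_inner_le_norm _ _
      _ ≤ 1 / 2 * ‖g x‖ * ‖g x‖ := by gcongr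
      _ = 1 / 2 * ‖g x‖ ^ 2 := by ring
  rw [inner_sub_left, real_inner_self_eq_norm_sq] at hinner
  rw [inner_neg_right, eq_div_iff (by linarith)] at hτ
  simp only [zero_smul, sub_zero] at hτ
  have hlow := hm (x - (1 / (2 * L)) • g x)
  have hstep : 1 / 2 * ‖g x‖ ^ 2 * (1 / (2 * L)) ≤ f x - m := by
    have := mul_le_mul_of_nonneg_right
      (show 1 / 2 * ‖g x‖ ^ 2 ≤ inner ℝ (g (x - τ • g x)) (g x) by linarith) ht.le
    linarith
  calc ‖g x‖ ^ 2 = 4 * L * (1 / 2 * ‖g x‖ ^ 2 * (1 / (2 * L))) := by field_simp; norm_num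
    _ ≤ 4 * L * (f x - m) := by gcongr

/-- The gradient of a constant multiple of a finite sum. -/
theorem gradient_const_mul_sum
    {E ι : Type*} [NormedAddCommGroup E] [InnerProductSpace ℝ E] [Fintype ι]
    {f : ι → E → ℝ} {g : ι → E} {G x : E} {c : ℝ}
    (hg : ∀ j, HasFDerivAt (f j) (innerSL ℝ (g j)) x)
    (hG : HasFDerivAt (fun z => c * ∑ j, f j z) (innerSL ℝ G) x) :
    G = c • ∑ j, g j := by
  have h := hG.unique ((HasFDerivAt.fun_sum fun j (_ : j ∈ Finset.univ) => hg j).const_mul c)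
  refine ext_inner_right ℝ fun v => ?_
  have hv := DFunLike.congr_fun h v
  simpa [inner_smul_left, sum_inner] using hv

/-- Jensen's inequality for the squared norm of an average. -/
theorem norm_average_sq_le {E : Type*} [NormedAddCommGroup E] [NormedSpace ℝ E]
    (n : ℕ) (v : Fin n → E) :
    ‖(1 / (n : ℝ)) • ∑ j, v j‖ ^ 2 ≤ (1 / (n : ℝ)) * ∑ j, ‖v j‖ ^ 2 := by
  rcases Nat.eq_zero_or_pos n with rfl | hn
  · simp
  have hn' : (0 : ℝ) < n := by exact_mod_cast hn
  have hsq : (∑ j, ‖v j‖) ^ 2 ≤ n * ∑ j, ‖v j‖ ^ 2 := by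
    simpa using sq_sum_le_card_mul_sum_sq (s := Finset.univ) (f := fun j => ‖v j‖)
  calc ‖(1 / (n : ℝ)) • ∑ j, v j‖ ^ 2 = (1 / (n : ℝ)) ^ 2 * ‖∑ j, v j‖ ^ 2 := by
        rw [norm_smul, mul_pow, Real.norm_of_nonneg (by positivity)]
    _ ≤ (1 / (n : ℝ)) ^ 2 * (∑ j, ‖v j‖) ^ 2 := by gcongr; exact norm_sum_le _ _
    _ ≤ (1 / (n : ℝ)) ^ 2 * (n * ∑ j, ‖v j‖ ^ 2) := by gcongr
    _ = (1 / (n : ℝ)) * ∑ j, ‖v j‖ ^ 2 := by field_simp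

/-- The bound `‖a + b + c + d‖² ≤ 2‖a‖² + 6(‖b‖² + ‖c‖² + ‖d‖²)`. -/
theorem norm_add_four_sq_le {E : Type*} [SeminormedAddCommGroup E] (a b c d : E) :
    ‖a + b + c + d‖ ^ 2 ≤ 2 * ‖a‖ ^ 2 + 6 * (‖b‖ ^ 2 + ‖c‖ ^ 2 + ‖d‖ ^ 2) := by
  have h : ‖a + b + c + d‖ ≤ ‖a‖ + ‖b‖ + ‖c‖ + ‖d‖ := norm_add₄_le
  calc ‖a + b + c + d‖ ^ 2 ≤ (‖a‖ + ‖b‖ + ‖c‖ + ‖d‖) ^ 2 := by gcongr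
    _ ≤ _ := by
      nlinarith [sq_nonneg (‖a‖ - (‖b‖ + ‖c‖ + ‖d‖)), sq_nonneg (‖b‖ - ‖c‖),
        sq_nonneg (‖b‖ - ‖d‖), sq_nonneg (‖c‖ - ‖d‖)]

/-- bound on the squared norm of the expected APFL update direction
`α²·∇f_i(v̄) + (1−α)·(1/n)·Σ_j ∇f_j(w_j)`, where `v̄ = v̂ + (1−α)·(w_i − w)`, in terms
of the suboptimality of `v̂`, the deviations of the local copies of the global model,
and the local–global gradient gap at `v̂` and `w`.
Here `gf j x` is the gradient of `f j` at `x` (via `HasFDerivAt (f j) (innerSL ℝ (gf j x)) x`),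
and `gF x` is the gradient of `F = (1/n)·Σ_j f_j` at `x`. -/
theorem apfl_update_direction_norm_bound
    {E : Type*} [NormedAddCommGroup E] [InnerProductSpace ℝ E]
    (n : ℕ) (hn : 1 ≤ n) (f : Fin n → E → ℝ) (gf : Fin n → E → E)
    (L : ℝ) (hL : 0 < L)
    (hgf : ∀ j x, HasFDerivAt (f j) (innerSL ℝ (gf j x)) x)
    (hLip : ∀ j x y, ‖gf j x - gf j y‖ ≤ L * ‖x - y‖)
    (gF : E → E)
    (hgF : ∀ x, HasFDerivAt (fun z => (1 / (n : ℝ)) * ∑ j, f j z) (innerSL ℝ (gF x)) x)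
    (i : Fin n) (fistar : ℝ) (hglb : IsGLB (Set.range (f i)) fistar)
    (α : ℝ) (hα0 : 0 ≤ α) (hα1 : α ≤ 1)
    (vhat w : E) (ws : Fin n → E) :
    ‖α ^ 2 • gf i (vhat + (1 - α) • (ws i - w))
        + ((1 - α) / (n : ℝ)) • ∑ j, gf j (ws j)‖ ^ 2
      ≤ 8 * L * (α ^ 2 + 1 - α) * (f i vhat - fistar)
        + 4 * (1 - α) ^ 2 * L ^ 2 * ‖w - ws i‖ ^ 2
        + 6 * (1 - α) ^ 2
            * (L ^ 2 * ‖w - ws i‖ ^ 2 + ‖gf i vhat - gF w‖ ^ 2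
                + (L ^ 2 / (n : ℝ)) * ∑ j, ‖w - ws j‖ ^ 2) := by
  have hn' : (0 : ℝ) < n := by exact_mod_cast hn
  have hβ : 0 ≤ 1 - α := by linarith
  have hα4 : (α ^ 2) ^ 2 ≤ 1 := pow_le_one₀ (by positivity) (pow_le_one₀ hα0 hα1)
  have hs0 : 0 ≤ α ^ 2 + 1 - α := by nlinarith
  have hs1 : α ^ 2 + 1 - α ≤ 1 := by nlinarith
  have hm (x : E) : fistar ≤ f i x := hglb.1 ⟨x, rfl⟩
  have hgrad := norm_gradient_sq_le_of_lipschitz hL (hgf i) (hLip i) hm vhat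
  have hmean : gF w = (1 / (n : ℝ)) • ∑ j, gf j w :=
    gradient_const_mul_sum (fun j => hgf j w) (hgF w)
  have hlocal : ‖gf i (vhat + (1 - α) • (ws i - w)) - gf i vhat‖ ^ 2
      ≤ (1 - α) ^ 2 * (L ^ 2 * ‖w - ws i‖ ^ 2) := by
    have h := hLip i (vhat + (1 - α) • (ws i - w)) vhat
    rw [add_sub_cancel_left, norm_smul, Real.norm_of_nonneg hβ, norm_sub_rev (ws i)] at h
    calc _ ≤ (L * ((1 - α) * ‖w - ws i‖)) ^ 2 := by gcongr
      _ = _ := by ring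
  have hglobal : ‖(1 / (n : ℝ)) • ∑ j, gf j (ws j) - gF w‖ ^ 2
      ≤ L ^ 2 / (n : ℝ) * ∑ j, ‖w - ws j‖ ^ 2 := by
    rw [hmean, ← smul_sub, ← Finset.sum_sub_distrib]
    calc _ ≤ (1 / (n : ℝ)) * ∑ j, ‖gf j (ws j) - gf j w‖ ^ 2 := norm_average_sq_le n _
      _ ≤ (1 / (n : ℝ)) * ∑ j, (L * ‖w - ws j‖) ^ 2 := by
        gcongr with j
        rw [norm_sub_rev w]
        exact hLip j _ _
      _ = _ := by simp only [mul_pow, ← Finset.mul_sum]; ring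
  have hsplit : α ^ 2 • gf i (vhat + (1 - α) • (ws i - w))
        + ((1 - α) / (n : ℝ)) • ∑ j, gf j (ws j)
      = (α ^ 2 + 1 - α) • gf i vhat
        + α ^ 2 • (gf i (vhat + (1 - α) • (ws i - w)) - gf i vhat)
        + (1 - α) • (gF w - gf i vhat)
        + (1 - α) • ((1 / (n : ℝ)) • ∑ j, gf j (ws j) - gF w) := by
    module
  have hmain : (α ^ 2 + 1 - α) ^ 2 * ‖gf i vhat‖ ^ 2
      ≤ (α ^ 2 + 1 - α) * (4 * L * (f i vhat - fistar)) :=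
    mul_le_mul (by nlinarith) hgrad (by positivity) hs0
  have hdrift : (α ^ 2) ^ 2 * ‖gf i (vhat + (1 - α) • (ws i - w)) - gf i vhat‖ ^ 2
      ≤ (1 - α) ^ 2 * (L ^ 2 * ‖w - ws i‖ ^ 2) :=
    (mul_le_of_le_one_left (by positivity) hα4).trans hlocal
  have havg := mul_le_mul_of_nonneg_left hglobal (sq_nonneg (1 - α))
  have hslack : 0 ≤ 4 * (1 - α) ^ 2 * L ^ 2 * ‖w - ws i‖ ^ 2 := by positivity
  have h := norm_add_four_sq_le ((α ^ 2 + 1 - α) • gf i vhat)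
    (α ^ 2 • (gf i (vhat + (1 - α) • (ws i - w)) - gf i vhat))
    ((1 - α) • (gF w - gf i vhat))
    ((1 - α) • ((1 / (n : ℝ)) • ∑ j, gf j (ws j) - gF w))
  rw [← hsplit, norm_smul, norm_smul (α ^ 2) (gf i (vhat + (1 - α) • (ws i - w)) - gf i vhat),
    norm_smul (1 - α) (gF w - gf i vhat),
    norm_smul (1 - α) ((1 / (n : ℝ)) • ∑ j, gf j (ws j) - gF w), norm_sub_rev (gF w)] at h
  simp only [mul_pow, Real.norm_eq_abs, sq_abs] at h
  linarith
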